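/- arXiv:2102.02608 — 10 statements merged into one kernel-verified Lean document; each statement's English description precedes it below -/
import Mathlib

section
/- Let k ≤ n be positive integers, let G=([n],E) be a hypergraph, and let g : [n] → [χ] be a valid k-coloring of G (every edge receives at least k distinct colors). Let F be a finite alphabet and let C : F^k → F^χ be an encoding that is erasure-good for the complete k-uniform hypergraph κ_{χ,k}, i.e., for every k-element subset S of [χ] the map m ↦ C(m)|_S is injective. Then the encoding C' : F^k → F^n defined by C'(m)_i = C(m)_{g(i)} is erasure-good for G. In particular, the minimum alphabet size q_k(G) for an erasure code for G is at most the minimum alphabet size of a (χ_k(G),k) MDS code. -/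
/-- An encoding `C : F^k → F^n` is *erasure-good* for the hypergraph on `[n]` with
edge set `E` (edges are decoding sets) if for every edge `e ∈ E` the restriction
of codewords to the coordinates in `e` determines the message. -/
def ErasureGood {F : Type*} {k n : ℕ} (E : Finset (Finset (Fin n)))
    (C : (Fin k → F) → (Fin n → F)) : Prop :=
  ∀ e ∈ E, ∀ m₁ m₂ : Fin k → F, (∀ i ∈ e, C m₁ i = C m₂ i) → m₁ = m₂

/-- if `g : [n] → [χ]` is a valid `k`-coloring of `G = ([n], E)` and
`C : F^k → F^χ` is erasure-good for the complete `k`-uniform hypergraph `κ_{χ,k}`,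
then `C'(m)_i = C(m)_{g(i)}` is erasure-good for `G`. -/
theorem stmt0 {k n χ : ℕ} (hk : 0 < k) (hkn : k ≤ n)
    (E : Finset (Finset (Fin n)))
    (g : Fin n → Fin χ)
    (hg : ∀ e ∈ E, k ≤ (e.image g).card)
    (F : Type*) [Fintype F]
    (C : (Fin k → F) → (Fin χ → F))
    (hC : ErasureGood ((Finset.univ : Finset (Fin χ)).powersetCard k) C) :
    ErasureGood E (fun m i => C m (g i)) := by
  intro e he m₁ m₂ h
  obtain ⟨S, hS, hcard⟩ := Finset.exists_subset_card_eq (hg e he)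
  refine hC S (Finset.mem_powersetCard.2 ⟨Finset.subset_univ S, hcard⟩) m₁ m₂ fun j hj => ?_
  obtain ⟨i, hi, rfl⟩ := Finset.mem_image.1 (hS hj)
  exact h i hi
end

section
/- Let k be a positive integer and let G=([n],E) be a hypergraph all of whose edges have size at least k, and suppose G admits a valid k-coloring with χ colors. Then for every finite field F with |F| ≥ χ − 1 there exists an injective F-linear encoding C : F^k → F^n that is erasure-good for G. In particular, q_{k,lin}(G) ≤ [χ_k(G) − 1]_pp, the smallest prime power that is at least χ_k(G) − 1. -/
open Polynomial in
/-- Evaluation of polynomials at points of the projective line `Option F`; the value at the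
point at infinity `none` is the coefficient of `X ^ d`. -/
noncomputable def projectiveEval (F : Type*) [Field F] (d : ℕ) (x : Option F) : F[X] →ₗ[F] F :=
  x.elim (lcoeff F d) leval

open Polynomial in
theorem eq_zero_of_projectiveEval_eq_zero {F : Type*} [Field F] {d : ℕ} {p : F[X]}
    (hp : p.degree < (d + 1 : ℕ)) (S : Finset (Option F)) (hS : d + 1 ≤ S.card)
    (h : ∀ x ∈ S, projectiveEval F d x p = 0) : p = 0 := by
  have heval : ∀ a ∈ S.eraseNone, p.eval a = 0 := fun a ha =>
    h (some a) (Finset.mem_eraseNone.1 ha)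
  refine eq_zero_of_degree_lt_of_eval_finset_eq_zero S.eraseNone ?_ heval
  by_cases hn : none ∈ S
  · have hcoeff : p.coeff d = 0 := h none hn
    have hd : p.degree < (d : ℕ) := by
      rw [degree_lt_iff_coeff_zero] at hp ⊢
      intro m hm
      rcases hm.eq_or_lt with rfl | hm
      · exact hcoeff
      · exact hp m hm
    refine hd.trans_le ?_
    rw [Finset.card_eraseNone_of_mem hn]
    exact_mod_cast Nat.le_sub_of_add_le hS
  · refine hp.trans_le ?_
    rw [Finset.card_eraseNone_of_not_mem hn]
    exact_mod_cast hS

theorem exists_injective_linearMap_fin (F : Type*) [Field F] {k n : ℕ} (hkn : k ≤ n) :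
    ∃ C : (Fin k → F) →ₗ[F] (Fin n → F), Function.Injective C :=
  ⟨Function.ExtendByZero.linearMap F (Fin.castLE hkn),
    Function.extend_injective (Fin.castLE_injective hkn) 0⟩

theorem ErasureGood.injective {F : Type*} {k n : ℕ} {E : Finset (Finset (Fin n))}
    {C : (Fin k → F) → (Fin n → F)} (hC : ErasureGood E C) (hE : E.Nonempty) :
    Function.Injective C := by
  obtain ⟨e, he⟩ := hE
  exact fun m₁ m₂ h => hC e he m₁ m₂ fun i _ => congrFun h i

/-- if all edges of `G = ([n], E)` have size at least `k` and `G` admits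
a valid `k`-coloring with `χ` colors, then over every finite field `F` with
`|F| ≥ χ - 1` there is an injective `F`-linear erasure-good encoding for `G`
(in particular `q_{k,lin}(G) ≤ [χ_k(G) - 1]_pp`). -/
theorem stmt1 {k n χ : ℕ} (hk : 0 < k) (hkn : k ≤ n)
    (E : Finset (Finset (Fin n)))
    (hE : ∀ e ∈ E, k ≤ e.card)
    (g : Fin n → Fin χ)
    (hg : ∀ e ∈ E, k ≤ (e.image g).card)
    (F : Type*) [Field F] [Fintype F]
    (hF : χ - 1 ≤ Fintype.card F) :
    ∃ C : (Fin k → F) →ₗ[F] (Fin n → F),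
      Function.Injective C ∧ ErasureGood E (fun m => C m) := by
  rcases E.eq_empty_or_nonempty with rfl | hne
  · obtain ⟨C, hC⟩ := exists_injective_linearMap_fin F hkn
    exact ⟨C, hC, by simp [ErasureGood]⟩
  · obtain ⟨d, rfl⟩ := Nat.exists_eq_add_of_lt hk
    rw [zero_add] at *
    classical
    obtain ⟨φ⟩ : Nonempty (Fin χ ↪ Option F) := by
      apply Function.Embedding.nonempty_of_card_le
      rw [Fintype.card_fin, Fintype.card_option]
      lia
    let P : (Fin (d + 1) → F) →ₗ[F] Polynomial F :=
      (Polynomial.degreeLT F (d + 1)).subtype ∘ₗ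
        (Polynomial.degreeLTEquiv F (d + 1)).symm.toLinearMap
    have hP : Function.Injective P :=
      Subtype.val_injective.comp (Polynomial.degreeLTEquiv F (d + 1)).symm.injective
    let C : (Fin (d + 1) → F) →ₗ[F] (Fin n → F) :=
      LinearMap.pi fun i => projectiveEval F d (φ (g i)) ∘ₗ P
    have hC : ErasureGood E (fun m => C m) := by
      intro e he m₁ m₂ h
      rw [← sub_eq_zero, ← map_eq_zero_iff P hP]
      refine eq_zero_of_projectiveEval_eq_zero
        (Polynomial.mem_degreeLT.1 (Subtype.prop _)) ((e.image g).map φ)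
        (by simpa using hg e he) fun x hx => ?_
      obtain ⟨c, hc, rfl⟩ := Finset.mem_map.1 hx
      obtain ⟨i, hi, rfl⟩ := Finset.mem_image.1 hc
      rw [map_sub, map_sub, sub_eq_zero]
      exact h i hi
    exact ⟨C, hC.injective hne, hC⟩
end

section
/- Let q ≥ 2 and k ≥ 1 be integers, let G=([n],E) be a k-uniform hypergraph in which every vertex belongs to at least one edge, and let F be an alphabet with |F| = q. Suppose C : F^k → F^n is erasure-good for G. Then, identifying F with {0,…,q−1} and fixing a bijection F^k ≃ [q^k], the map φ sending each vertex i ∈ [n] to the vector (C(m)_i)_{m ∈ F^k} sends every vertex of G to a vertex (a balanced vector) of G_{q,k} and every edge of G to an edge of G_{q,k}. Consequently, every valid k-coloring of G_{q,k} with c colors induces a valid k-coloring of G with at most c colors, so χ_k(G) ≤ χ_k(G_{q,k}). -/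
/-- A vector `u ∈ F^{q^k}` is *balanced* if every symbol of the (size-`q`) alphabet `F`
occurs exactly `q^(k-1)` times among its coordinates. -/
def BalancedVec {F : Type*} [DecidableEq F] (q k : ℕ) (u : Fin (q ^ k) → F) : Prop :=
  ∀ a : F, (Finset.univ.filter fun i => u i = a).card = q ^ (k - 1)

/-- A finite set `s` of vectors in `F^{q^k}` is an edge of the hypergraph `G_{q,k}`
if it consists of `k` balanced vectors and the collection of `k`-tuples obtained by
reading off the coordinates of the vectors of `s` (over all `q^k` positions) is exactly
`F^k`, each tuple occurring once. -/
def IsGEdge {F : Type*} [DecidableEq F] (q k : ℕ) (s : Finset (Fin (q ^ k) → F)) : Prop :=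
  s.card = k ∧ (∀ u ∈ s, BalancedVec q k u) ∧
    Function.Bijective fun (i : Fin (q ^ k)) (u : {x // x ∈ s}) => u.1 i

/-- If reading off coordinates identifies `Fin (q ^ k)` with all functions from a `k`-element
type to `Fin q`, then every coordinate takes each value `q ^ (k - 1)` times. -/
theorem balancedVec_of_bijective {q k : ℕ} {κ : Type*} [Fintype κ] (hκ : Fintype.card κ = k)
    {g : Fin (q ^ k) → κ → Fin q} (hg : Function.Bijective g) (x : κ) :
    BalancedVec q k (fun j => g j x) := by
  classical
  intro a
  have hcount : (Finset.univ.filter fun j => g j x = a).card =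
      (Finset.univ.filter fun h : κ → Fin q => h x = a).card :=
    Finset.card_bijective g hg (by simp)
  rw [hcount]
  have h := Fintype.card_filter_piFinset_const_eq_of_mem (Finset.univ : Finset (Fin q)) x
    (Finset.mem_univ a)
  rw [Fintype.piFinset_univ] at h
  rw [h, hκ, Finset.card_univ, Fintype.card_fin]

/-- If the values of the `φ i`, `i ∈ e`, determine the position, then the vectors `φ i` are jointly
bijective onto all functions `e → Fin q`. -/
theorem bijective_restrict_of_separates {q k : ℕ} {ι : Type*} {e : Finset ι} (he : e.card = k)
    {φ : ι → Fin (q ^ k) → Fin q} (hφ : ∀ j₁ j₂, (∀ i ∈ e, φ i j₁ = φ i j₂) → j₁ = j₂) :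
    Function.Bijective fun (j : Fin (q ^ k)) (i : {x // x ∈ e}) => φ i.1 j := by
  classical
  rw [Fintype.bijective_iff_injective_and_card]
  refine ⟨fun j₁ j₂ h => hφ j₁ j₂ fun i hi => congrFun h ⟨i, hi⟩, ?_⟩
  simp [he]

/-- If the values of the `φ i`, `i ∈ e`, determine the position, then each `φ i` with `i ∈ e` is
balanced. -/
theorem balancedVec_of_separates {q k : ℕ} {ι : Type*} {e : Finset ι} (he : e.card = k)
    {φ : ι → Fin (q ^ k) → Fin q} (hφ : ∀ j₁ j₂, (∀ i ∈ e, φ i j₁ = φ i j₂) → j₁ = j₂)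
    {i : ι} (hi : i ∈ e) : BalancedVec q k (φ i) :=
  balancedVec_of_bijective (by simpa using he) (bijective_restrict_of_separates he hφ) ⟨i, hi⟩

/-- If the values of the `φ i`, `i ∈ e`, determine the position, then `φ` maps `e` to an edge
of `G_{q,k}`. -/
theorem isGEdge_image_of_separates {q k : ℕ} (hq : 2 ≤ q) {ι : Type*} {e : Finset ι}
    (he : e.card = k) {φ : ι → Fin (q ^ k) → Fin q}
    (hφ : ∀ j₁ j₂, (∀ i ∈ e, φ i j₁ = φ i j₂) → j₁ = j₂) :
    IsGEdge q k (e.image φ) := by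
  classical
  have hinj : Set.InjOn φ e := by
    intro i hi i' hi' h
    by_contra hne
    obtain ⟨j, hj⟩ := (bijective_restrict_of_separates he hφ).2
      fun x => if x.1 = i then ⟨0, by omega⟩ else ⟨1, by omega⟩
    have h₁ := congrFun hj ⟨i, hi⟩
    have h₂ := congrFun hj ⟨i', hi'⟩
    simp only [if_true, if_neg (Ne.symm hne)] at h₁ h₂
    rw [h, h₂] at h₁
    simp at h₁
  have hcard : (e.image φ).card = k := by rw [Finset.card_image_of_injOn hinj, he]
  refine ⟨hcard, ?_, ?_⟩
  · intro u hu
    obtain ⟨i, hi, rfl⟩ := Finset.mem_image.1 hu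
    exact balancedVec_of_separates he hφ hi
  · exact bijective_restrict_of_separates (φ := fun u => u) hcard fun j₁ j₂ h =>
      hφ j₁ j₂ fun i hi => h (φ i) (Finset.mem_image_of_mem φ hi)

/-- if `G = ([n], E)` is a `k`-uniform hypergraph in which every vertex lies
in an edge, `|F| = q`, and `C : F^k → F^n` is erasure-good for `G`, then (identifying `F`
with `Fin q` via `τ` and `F^k` with `[q^k]` via `σ`) the map `φ : i ↦ (C(m)_i)_{m ∈ F^k}`
sends every vertex of `G` to a balanced vector, sends every edge of `G` to an edge of
`G_{q,k}`, and consequently every valid `k`-coloring of `G_{q,k}` with `c` colors induces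
a valid `k`-coloring of `G` with at most `c` colors (so `χ_k(G) ≤ χ_k(G_{q,k})`). -/
theorem stmt3 {n k q : ℕ} (hq : 2 ≤ q) (hk : 1 ≤ k)
    (E : Finset (Finset (Fin n)))
    (huniform : ∀ e ∈ E, e.card = k)
    (hcover : ∀ i : Fin n, ∃ e ∈ E, i ∈ e)
    (F : Type*) [Fintype F] [DecidableEq F] (hF : Fintype.card F = q)
    (τ : F ≃ Fin q) (σ : (Fin k → F) ≃ Fin (q ^ k))
    (C : (Fin k → F) → (Fin n → F))
    (hC : ∀ e ∈ E, ∀ m₁ m₂ : Fin k → F, (∀ i ∈ e, C m₁ i = C m₂ i) → m₁ = m₂) :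
    (∀ i : Fin n, BalancedVec q k (fun j : Fin (q ^ k) => τ (C (σ.symm j) i))) ∧
    (∀ e ∈ E, IsGEdge q k (e.image fun i => fun j : Fin (q ^ k) => τ (C (σ.symm j) i))) ∧
    (∀ (c : ℕ) (col : (Fin (q ^ k) → Fin q) → Fin c),
      (∀ s : Finset (Fin (q ^ k) → Fin q), IsGEdge q k s → k ≤ (s.image col).card) →
      ∀ e ∈ E,
        k ≤ (e.image fun i => col (fun j : Fin (q ^ k) => τ (C (σ.symm j) i))).card) := by
  have hsep : ∀ e ∈ E, ∀ j₁ j₂ : Fin (q ^ k),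
      (∀ i ∈ e, τ (C (σ.symm j₁) i) = τ (C (σ.symm j₂) i)) → j₁ = j₂ := fun e he j₁ j₂ h =>
    σ.symm.injective (hC e he _ _ fun i hi => τ.injective (h i hi))
  have hedge : ∀ e ∈ E,
      IsGEdge q k (e.image fun i => fun j : Fin (q ^ k) => τ (C (σ.symm j) i)) := fun e he => by
    convert isGEdge_image_of_separates hq (huniform e he) (hsep e he)
  refine ⟨fun i => ?_, hedge, fun c col hcol e he => ?_⟩
  · obtain ⟨e, he, hi⟩ := hcover i
    exact balancedVec_of_separates (φ := fun i j => τ (C (σ.symm j) i)) (huniform e he)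
      (hsep e he) hi
  · simpa only [Finset.image_image, Function.comp_def] using hcol _ (hedge e he)
end

section
/- For every prime power q and every integer k ≥ 2, every valid k-coloring of the hypergraph G_{q,k} uses at least (q^k − 1)/(q − 1) colors; that is, χ_k(G_{q,k}) ≥ (q^k − 1)/(q − 1). -/
open scoped LinearAlgebra.Projectivization

/-- If reading off the coordinates of the vectors of `s` is a bijection onto the tuples, then
every vector of `s` is balanced. -/
theorem BalancedVec.of_bijective {q k : ℕ} {s : Finset (Fin (q ^ k) → Fin q)} (hs : s.card = k)
    (h : Function.Bijective fun (i : Fin (q ^ k)) (u : {x // x ∈ s}) => u.1 i)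
    {u : Fin (q ^ k) → Fin q} (hu : u ∈ s) : BalancedVec q k u := by
  intro a
  have hcard := Fintype.card_filter_piFinset_const (Finset.univ : Finset (Fin q))
    (⟨u, hu⟩ : {x // x ∈ s}) a
  simp only [Fintype.piFinset_univ, Finset.mem_univ, if_true, Finset.card_univ, Fintype.card_fin,
    Fintype.card_coe, hs] at hcard
  rw [← hcard]
  refine Finset.card_bijective _ h fun i => ?_
  simp

/-- The vector of values of the linear form `w ⬝ᵥ ·`, with positions and symbols relabelled. -/
def dotProductVec {F : Type*} [Field F] {q k : ℕ} (e : F ≃ Fin q) (f : Fin (q ^ k) ≃ (Fin k → F))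
    (w : Fin k → F) : Fin (q ^ k) → Fin q :=
  fun i => e (w ⬝ᵥ f i)

theorem dotProductVec_injective {F : Type*} [Field F] {q k : ℕ} (e : F ≃ Fin q)
    (f : Fin (q ^ k) ≃ (Fin k → F)) : Function.Injective (dotProductVec e f) := by
  intro v w h
  refine dotProduct_eq v w fun u => ?_
  simpa [dotProductVec] using congrFun h (f.symm u)

/-- The vectors of values of the linear forms of a basis are an edge of `G_{q,k}`. -/
theorem isGEdge_image_dotProductVec {F ι : Type*} [Field F] [Fintype ι] {q k : ℕ} (e : F ≃ Fin q)
    (f : Fin (q ^ k) ≃ (Fin k → F)) (b : Module.Basis ι F (Fin k → F)) :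
    IsGEdge q k (Finset.univ.image fun j => dotProductVec e f (b j)) := by
  have hcard : (Finset.univ.image fun j => dotProductVec e f (b j)).card = k := by
    rw [Finset.card_image_of_injective _ (show Function.Injective fun j => dotProductVec e f (b j) from
        (dotProductVec_injective e f).comp b.injective),
      Finset.card_univ, ← Module.finrank_eq_card_basis b, Module.finrank_fin_fun]
  have hbij : Function.Bijective fun (i : Fin (q ^ k))
      (u : {x // x ∈ Finset.univ.image fun j => dotProductVec e f (b j)}) => u.1 i := by
    rw [Fintype.bijective_iff_injective_and_card]
    refine ⟨fun i i' h => f.injective ?_, ?_⟩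
    · have hb (j : ι) : b j ⬝ᵥ f i = b j ⬝ᵥ f i' := by
        have := congrFun h ⟨dotProductVec e f (b j),
          Finset.mem_image_of_mem _ (Finset.mem_univ j)⟩
        exact e.injective this
      have hlin : (dotProductBilin F F).flip (f i) = (dotProductBilin F F).flip (f i') :=
        b.ext hb
      refine dotProduct_eq _ _ fun u => ?_
      rw [dotProduct_comm, dotProduct_comm (f i')]
      exact LinearMap.congr_fun hlin u
    · rw [Fintype.card_fun, Fintype.card_coe, hcard, Fintype.card_fin, Fintype.card_fin]
  exact ⟨hcard, fun u hu => BalancedVec.of_bijective hcard hbij hu, hbij⟩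

/-- Linear forms representing distinct points of projective space get distinct colors in a
valid `k`-coloring. -/
theorem injective_coloring_rep {F : Type*} [Field F] {q k c : ℕ} (e : F ≃ Fin q)
    (f : Fin (q ^ k) ≃ (Fin k → F)) (col : (Fin (q ^ k) → Fin q) → Fin c)
    (hcol : ∀ s : Finset (Fin (q ^ k) → Fin q), IsGEdge q k s → k ≤ (s.image col).card) :
    Function.Injective fun p : ℙ F (Fin k → F) => col (dotProductVec e f p.rep) := by
  intro p p' h
  by_contra hne
  have hli := Projectivization.independent_iff.1
    ((Projectivization.independent_pair_iff_ne p p').2 hne)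
  let b := Module.Basis.extend hli.linearIndepOn_id
  have : Fintype _ := FiniteDimensional.fintypeBasisIndex b
  have hedge := isGEdge_image_dotProductVec e f b
  have hinj : Set.InjOn col (Finset.univ.image fun j => dotProductVec e f (b j)) := by
    rw [← Finset.card_image_iff]
    exact le_antisymm Finset.card_image_le (hedge.1.trans_le (hcol _ hedge))
  have hmem (i : Fin 2) : dotProductVec e f (![p, p'] i).rep ∈
      Finset.univ.image fun j => dotProductVec e f (b j) := by
    refine Finset.mem_image.2 ⟨⟨(![p, p'] i).rep,
      Module.Basis.subset_extend hli.linearIndepOn_id ⟨i, rfl⟩⟩, Finset.mem_univ _, ?_⟩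
    rw [Module.Basis.extend_apply_self]
  have hrep : p.rep = p'.rep := dotProductVec_injective e f (hinj (hmem 0) (hmem 1) h)
  exact zero_ne_one (hli.injective (show (Projectivization.rep ∘ ![p, p']) 0 = _ from hrep))

/-- for every prime power `q` and every `k ≥ 2`, every valid `k`-coloring
of `G_{q,k}` uses at least `(q^k - 1)/(q - 1)` colors: `χ_k(G_{q,k}) ≥ (q^k - 1)/(q - 1)`. -/
theorem stmt4 (q k : ℕ) (hq : IsPrimePow q) (hk : 2 ≤ k)
    (c : ℕ) (col : (Fin (q ^ k) → Fin q) → Fin c)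
    (hcol : ∀ s : Finset (Fin (q ^ k) → Fin q), IsGEdge q k s → k ≤ (s.image col).card) :
    (q ^ k - 1) / (q - 1) ≤ c := by
  obtain ⟨p, n, hp, hn, hpq⟩ := hq
  have := Fact.mk hp.nat_prime
  have hF : Nat.card (GaloisField p n) = q := (GaloisField.card p n hn.ne').trans hpq
  have e : GaloisField p n ≃ Fin q := Finite.equivFinOfCardEq hF
  have hV : Nat.card (Fin k → GaloisField p n) = q ^ k := by simp [Nat.card_fun, hF]
  have f : Fin (q ^ k) ≃ (Fin k → GaloisField p n) := (Finite.equivFinOfCardEq hV).symm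
  have hle := Nat.card_le_card_of_injective _ (injective_coloring_rep e f col hcol)
  rwa [Projectivization.card'', hV, hF, Nat.card_fin] at hle
end

section
/- For all integers q ≥ 2 and k ≥ 2, the hypergraph G_{q,k} admits a valid k-coloring with binom(q^{k−1}+1, q^{k−2}+1) colors; that is, χ_k(G_{q,k}) ≤ binom(q^{k−1}+1, q^{k−2}+1). -/
/-- In an edge of `G_{q,k}`, two distinct vertices take a prescribed pair of values on at most
`q^(k-2)` common coordinates. -/
theorem IsGEdge.card_filter_pair_le {q k : ℕ} {s : Finset (Fin (q ^ k) → Fin q)}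
    (hs : IsGEdge q k s) {u v : Fin (q ^ k) → Fin q} (hu : u ∈ s) (hv : v ∈ s) (huv : u ≠ v)
    (a b : Fin q) :
    (Finset.univ.filter fun i => u i = a ∧ v i = b).card ≤ q ^ (k - 2) := by
  obtain ⟨hcard, -, hbij⟩ := hs
  have hrest : ((s.erase u).erase v).card = k - 2 := by
    rw [Finset.card_erase_of_mem (Finset.mem_erase.2 ⟨huv.symm, hv⟩),
      Finset.card_erase_of_mem hu, hcard, Nat.sub_sub]
  have hfun : Fintype.card ({x // x ∈ (s.erase u).erase v} → Fin q) = q ^ (k - 2) := by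
    simp only [Fintype.card_fun, Fintype.card_fin, Fintype.card_coe, hrest]
  rw [← hfun, ← Finset.card_univ]
  refine Finset.card_le_card_of_injOn (fun i w => w.1 i) (fun _ _ => Finset.mem_univ _) ?_
  intro i hi j hj hij
  obtain ⟨hiu, hiv⟩ := (Finset.mem_filter.1 hi).2
  obtain ⟨hju, hjv⟩ := (Finset.mem_filter.1 hj).2
  refine hbij.1 (funext fun w => ?_)
  by_cases hwu : w.1 = u
  · simp only [hwu, hiu, hju]
  by_cases hwv : w.1 = v
  · simp only [hwv, hiv, hjv]
  exact congrFun hij ⟨w.1, Finset.mem_erase.2 ⟨hwv, Finset.mem_erase.2 ⟨hwu, w.2⟩⟩⟩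

/-- A function from a set of size greater than `q * m` to `q` symbols is constant on some subset
of size `m + 1`. -/
theorem exists_card_eq_and_constant {α : Type*} [Fintype α] {q m : ℕ}
    (h : q * m < Fintype.card α) (f : α → Fin q) :
    ∃ A : {A : Finset α // A.card = m + 1}, ∃ a, ∀ i ∈ A.1, f i = a := by
  obtain ⟨a, ha⟩ := Fintype.exists_lt_card_fiber_of_mul_lt_card f (n := m) (by simpa using h)
  obtain ⟨A, hA, hcard⟩ := Finset.exists_subset_card_eq (Nat.succ_le_of_lt ha)
  exact ⟨⟨A, hcard⟩, a, fun i hi => (Finset.mem_filter.1 (hA hi)).2⟩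

/-- for all `q ≥ 2` and `k ≥ 2`, the hypergraph `G_{q,k}` admits a valid
`k`-coloring with `binom(q^(k-1)+1, q^(k-2)+1)` colors:
`χ_k(G_{q,k}) ≤ binom(q^(k-1)+1, q^(k-2)+1)`. -/
theorem stmt5 (q k : ℕ) (hq : 2 ≤ q) (hk : 2 ≤ k) :
    ∃ col : (Fin (q ^ k) → Fin q) → Fin ((q ^ (k - 1) + 1).choose (q ^ (k - 2) + 1)),
      ∀ s : Finset (Fin (q ^ k) → Fin q), IsGEdge q k s → k ≤ (s.image col).card := by
  have hpow : q * q ^ (k - 2) = q ^ (k - 1) := by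
    rw [← pow_succ']
    congr 1
    omega
  have hle : q ^ (k - 1) + 1 ≤ q ^ k :=
    Nat.succ_le_of_lt (Nat.pow_lt_pow_right hq (by omega))
  have hconst (u : Fin (q ^ k) → Fin q) :=
    exists_card_eq_and_constant (α := Fin (q ^ (k - 1) + 1)) (m := q ^ (k - 2))
      (by rw [hpow, Fintype.card_fin]; exact Nat.lt_succ_self _)
      (fun i => u (Fin.castLE hle i))
  choose A a hA using hconst
  let e := Fintype.equivFinOfCardEq
    (α := {A : Finset (Fin (q ^ (k - 1) + 1)) // A.card = q ^ (k - 2) + 1})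
    (by rw [Fintype.card_finset_len, Fintype.card_fin])
  refine ⟨fun u => e (A u), fun s hs => ?_⟩
  rw [Finset.card_image_of_injOn, hs.1]
  intro u hu v hv huv
  by_contra hne
  have hAuv : A u = A v := e.injective huv
  have hsub : (A u).1.map (Fin.castLEEmb hle) ⊆
      Finset.univ.filter fun i => u i = a u ∧ v i = a v := by
    intro i hi
    obtain ⟨j, hj, rfl⟩ := Finset.mem_map.1 hi
    exact Finset.mem_filter.2 ⟨Finset.mem_univ _, hA u j hj, hA v j (hAuv ▸ hj)⟩
  have hcard := (Finset.card_le_card hsub).trans (hs.card_filter_pair_le hu hv hne (a u) (a v))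
  rw [Finset.card_map, (A u).2] at hcard
  omega
end

section
/- Let q ≥ 2 and k ≥ 2 be integers. If u and v are two distinct vertices of G_{q,k} that belong to a common edge, then for every pair of symbols (j_1, j_2) ∈ {0,…,q−1}² the number of coordinates i ∈ [q^k] with u_i = j_1 and v_i = j_2 equals exactly q^{k−2}. Consequently, for every set I of q^{k−2}+1 coordinates, the set A_I of all vertices of G_{q,k} that take a constant value on the coordinates in I is an independent set of G_{q,k}: no two vertices of A_I belong to a common edge. -/
/-- The number of functions with prescribed values at two distinct points. -/
theorem card_filter_apply_eq_and_apply_eq {ι α : Type*} [Fintype ι] [DecidableEq ι] [Fintype α]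
    [DecidableEq α] {a b : ι} (hab : a ≠ b) (x y : α) :
    (Finset.univ.filter fun f : ι → α => f a = x ∧ f b = y).card =
      Fintype.card α ^ (Fintype.card ι - 2) := by
  have h : (Finset.univ.filter fun f : ι → α => f a = x ∧ f b = y) =
      Fintype.piFinset fun c =>
        if c ∈ ({a, b} : Finset ι) then {if c = a then x else y} else Finset.univ := by
    ext f
    simp only [Finset.mem_filter, Finset.mem_univ, true_and, Fintype.mem_piFinset]
    constructor
    · rintro ⟨rfl, rfl⟩ c
      by_cases hca : c = a
      · simp [hca]
      · by_cases hcb : c = b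
        · simp [hcb, hab.symm]
        · simp [hca, hcb]
    · intro hf
      exact ⟨by simpa using hf a, by simpa [hab.symm] using hf b⟩
  rw [h, Fintype.card_piFinset]
  simp only [apply_ite Finset.card, Finset.card_singleton, Finset.card_univ]
  rw [Finset.prod_ite, Finset.prod_const_one, one_mul, Finset.prod_const, Finset.filter_not,
    Finset.filter_mem_eq_inter, Finset.univ_inter, ← Finset.compl_eq_univ_sdiff,
    Finset.card_compl, Finset.card_pair hab]

/-- Two distinct members of an edge take each pair of symbols equally often. -/
theorem IsGEdge.card_filter_pair {q k : ℕ} {s : Finset (Fin (q ^ k) → Fin q)}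
    (hs : IsGEdge q k s) {u v : Fin (q ^ k) → Fin q} (hu : u ∈ s) (hv : v ∈ s) (huv : u ≠ v)
    (j₁ j₂ : Fin q) :
    (Finset.univ.filter fun i => u i = j₁ ∧ v i = j₂).card = q ^ (k - 2) := by
  obtain ⟨hcard, -, hbij⟩ := hs
  have h := card_filter_apply_eq_and_apply_eq
    (a := (⟨u, hu⟩ : {x // x ∈ s})) (b := ⟨v, hv⟩) (by simpa using huv) j₁ j₂
  rw [Fintype.card_fin, Fintype.card_coe, hcard] at h
  rw [← h]
  refine Finset.card_bijective _ hbij fun i => ?_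
  simp

/-- for `q, k ≥ 2`, if `u ≠ v` are vertices of `G_{q,k}` lying in a common
edge, then for every pair of symbols `(j₁, j₂)` the number of coordinates `i` with
`u i = j₁` and `v i = j₂` is exactly `q^(k-2)`; consequently for every set `I` of
`q^(k-2)+1` coordinates, the set of vertices of `G_{q,k}` that are constant on `I` is an
independent set: no two of its members lie in a common edge. -/
theorem stmt7 (q k : ℕ) (hq : 2 ≤ q) (hk : 2 ≤ k) :
    (∀ u v : Fin (q ^ k) → Fin q, u ≠ v →
      (∃ s : Finset (Fin (q ^ k) → Fin q), IsGEdge q k s ∧ u ∈ s ∧ v ∈ s) →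
      ∀ j₁ j₂ : Fin q,
        (Finset.univ.filter fun i => u i = j₁ ∧ v i = j₂).card = q ^ (k - 2)) ∧
    (∀ I : Finset (Fin (q ^ k)), I.card = q ^ (k - 2) + 1 →
      ∀ u v : Fin (q ^ k) → Fin q, u ≠ v →
        BalancedVec q k u → BalancedVec q k v →
        (∃ cu : Fin q, ∀ i ∈ I, u i = cu) → (∃ cv : Fin q, ∀ i ∈ I, v i = cv) →
        ¬ ∃ s : Finset (Fin (q ^ k) → Fin q), IsGEdge q k s ∧ u ∈ s ∧ v ∈ s) := by
  refine ⟨fun u v huv ⟨s, hs, hu, hv⟩ => hs.card_filter_pair hu hv huv, ?_⟩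
  rintro I hI u v huv - - ⟨cu, hcu⟩ ⟨cv, hcv⟩ ⟨s, hs, hu, hv⟩
  have hle : I.card ≤ (Finset.univ.filter fun i => u i = cu ∧ v i = cv).card :=
    Finset.card_le_card fun i hi => by simp [hcu i hi, hcv i hi]
  rw [hs.card_filter_pair hu hv huv, hI] at hle
  omega
end

section
/- For every integer k ≥ 3 and every prime power q there exists a k-uniform hypergraph G = ([n], E) for some n such that G admits an F_q-linear erasure-good encoding C : F_q^k → F_q^n, yet every valid k-coloring of G requires at least (q^k − 1)/(q − 1) colors; i.e., q_{k,lin}(G) ≤ q while χ_k(G) ≥ (q^k − 1)/(q − 1). -/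
open Module in
theorem exists_finset_pair_mem_card_eq_span_eq_top {ι K V : Type*} [Fintype ι] [Field K]
    [AddCommGroup V] [Module K V] {v : ι → V} (hv : Submodule.span K (Set.range v) = ⊤)
    {i j : ι} (hij : LinearIndepOn K v {i, j}) :
    ∃ e : Finset ι, i ∈ e ∧ j ∈ e ∧ e.card = finrank K V ∧
      Submodule.span K (v '' (e : Set ι)) = ⊤ := by
  classical
  obtain ⟨b, -, hb, hspan, hli⟩ := exists_linearIndepOn_extension hij (Set.subset_univ _)
  have htop : Submodule.span K (v '' b) = ⊤ := by
    rw [eq_top_iff, ← hv, Submodule.span_le, ← Set.image_univ]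
    exact hspan
  refine ⟨b.toFinset, by simpa using hb (by simp), by simpa using hb (by simp), ?_, by simpa⟩
  have hrange : ⊤ ≤ Submodule.span K (Set.range fun x : b => v x) := by
    rw [← Set.image_eq_range, htop]
  rw [finrank_eq_card_basis (Basis.mk hli hrange), Set.toFinset_card]

theorem eq_of_dotProduct_eq_of_span_eq_top {k K : Type*} [Fintype k] [CommRing K]
    {s : Set (k → K)} (hs : Submodule.span K s = ⊤) {m₁ m₂ : k → K}
    (h : ∀ v ∈ s, v ⬝ᵥ m₁ = v ⬝ᵥ m₂) : m₁ = m₂ := by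
  refine dotProduct_eq _ _ fun u => ?_
  rw [dotProduct_comm m₁, dotProduct_comm m₂]
  have hu : u ∈ Submodule.span K s := hs ▸ Submodule.mem_top
  induction hu using Submodule.span_induction with
  | mem x hx => exact h x hx
  | zero => simp
  | add x y _ _ hx hy => simp only [add_dotProduct, hx, hy]
  | smul a x _ hx => simp only [smul_dotProduct, hx]

theorem Projectivization.span_range_rep (K V : Type*) [Field K] [AddCommGroup V] [Module K V] :
    Submodule.span K (Set.range (Projectivization.rep : Projectivization K V → V)) = ⊤ := by
  refine eq_top_iff.2 fun x _ => ?_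
  by_cases hx : x = 0
  · exact hx ▸ Submodule.zero_mem _
  obtain ⟨a, ha⟩ := Projectivization.exists_smul_eq_mk_rep K x hx
  rw [← inv_smul_smul a x, ha]
  exact Submodule.smul_of_tower_mem _ _ (Submodule.subset_span ⟨_, rfl⟩)

theorem Projectivization.linearIndepOn_rep_pair {K V : Type*} [Field K] [AddCommGroup V]
    [Module K V] {x y : Projectivization K V} (h : x ≠ y) :
    LinearIndepOn K Projectivization.rep {x, y} := by
  refine (linearIndepOn_pair_iff _ h x.rep_nonzero).2 fun a ha => h ?_
  rw [← x.mk_rep, ← y.mk_rep]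
  exact ((Projectivization.mk_eq_mk_iff' K _ _ y.rep_nonzero x.rep_nonzero).2 ⟨a, ha⟩).symm

theorem exists_linear_erasureGood_of_span_eq_top {K F : Type*} [Field K] [Field F]
    (φ : K ≃+* F) {k n : ℕ} (v : Fin n → Fin k → K) {E : Finset (Finset (Fin n))}
    (hE : ∀ e ∈ E, Submodule.span K (v '' (e : Set (Fin n))) = ⊤) :
    ∃ C : (Fin k → F) →ₗ[F] (Fin n → F), ErasureGood E (fun m => C m) := by
  refine ⟨Matrix.mulVecLin (Matrix.of fun i j => φ (v i j)), fun e he m₁ m₂ h => ?_⟩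
  suffices φ.symm ∘ m₁ = φ.symm ∘ m₂ from φ.symm.injective.comp_left this
  refine eq_of_dotProduct_eq_of_span_eq_top (hE e he) ?_
  rintro _ ⟨i, hi, rfl⟩
  apply φ.injective
  simpa [dotProduct, Matrix.mulVec] using h i hi

/-- for every `k ≥ 3` and every prime power `q` there exists a `k`-uniform
hypergraph `G = ([n], E)` that admits an `F_q`-linear erasure-good encoding (so
`q_{k,lin}(G) ≤ q`), yet every valid `k`-coloring of `G` needs at least
`(q^k - 1)/(q - 1)` colors (so `χ_k(G) ≥ (q^k - 1)/(q - 1)`). -/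
theorem stmt8 (k q : ℕ) (hk : 3 ≤ k) (hq : IsPrimePow q) :
    ∃ (n : ℕ) (E : Finset (Finset (Fin n))),
      (∀ e ∈ E, e.card = k) ∧
      (∀ (F : Type) [Field F] [Fintype F], Fintype.card F = q →
        ∃ C : (Fin k → F) →ₗ[F] (Fin n → F), ErasureGood E (fun m => C m)) ∧
      (∀ (c : ℕ) (col : Fin n → Fin c),
        (∀ e ∈ E, k ≤ (e.image col).card) → (q ^ k - 1) / (q - 1) ≤ c) := by
  classical
  obtain ⟨K, _, _, hK⟩ : ∃ (K : Type) (_ : Field K) (_ : Fintype K), Fintype.card K = q := by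
    obtain ⟨f⟩ := (Fintype.nonempty_field_iff (α := Fin q)).2 (by simpa using hq)
    exact ⟨Fin q, f, inferInstance, Fintype.card_fin q⟩
  let P := Projectivization K (Fin k → K)
  have hP : Nat.card P = (q ^ k - 1) / (q - 1) := by
    rw [Projectivization.card'']
    simp [hK]
  let g : Fin (Nat.card P) ≃ P := (Finite.equivFin P).symm
  let v : Fin (Nat.card P) → Fin k → K := fun i => (g i).rep
  have hv : Submodule.span K (Set.range v) = ⊤ := by
    rw [← Projectivization.span_range_rep K (Fin k → K)]
    exact congrArg _ (g.surjective.range_comp Projectivization.rep)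
  let E : Finset (Finset (Fin (Nat.card P))) :=
    {e | e.card = k ∧ Submodule.span K (v '' (e : Set (Fin (Nat.card P)))) = ⊤}
  refine ⟨Nat.card P, E, fun e he => (Finset.mem_filter.1 he).2.1, fun F _ _ hF => ?_,
    fun c col hcol => ?_⟩
  · exact exists_linear_erasureGood_of_span_eq_top
      (FiniteField.ringEquivOfCardEq (hK.trans hF.symm)) v
      fun e he => (Finset.mem_filter.1 he).2.2
  · rw [← hP]
    suffices Function.Injective col by simpa using Fintype.card_le_of_injective col this
    intro i j hij
    by_contra hne
    have hli : LinearIndepOn K v {i, j} := by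
      have := Projectivization.linearIndepOn_rep_pair (g.injective.ne hne)
      rw [← Set.image_pair] at this
      exact this.comp_of_image g.injective.injOn
    obtain ⟨e, hi, hj, hcard, hspan⟩ := exists_finset_pair_mem_card_eq_span_eq_top hv hli
    rw [Module.finrank_fin_fun] at hcard
    have hinj : Set.InjOn col e := Finset.card_image_iff.1 <|
      le_antisymm Finset.card_image_le
        (hcard.trans_le (hcol e (Finset.mem_filter.2 ⟨Finset.mem_univ _, hcard, hspan⟩)))
    exact hne (hinj hi hj hij)
end

section
/- Let k ≥ 1 and let G = ([n], E) be a hypergraph of error sets in which every edge has size at most (n−k)/2, where n−k is even. Let Ḡ = ([n], {[n]∖e : e ∈ E}), let g : [n] → [χ] be a valid strong-coloring of Ḡ with χ − k even, and suppose the alphabet F admits an encoding F^k → F^χ that is error-good for the complete hypergraph κ_{χ,(χ−k)/2} (whose edges are all subsets of [χ] of size (χ−k)/2). Then there exists an encoding F^k → F^n that is error-good for G. In particular, p_k(G) ≤ p_k(κ_{χ(Ḡ), ⌊(χ(Ḡ)−k)/2⌋}). -/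
/-- `overwrite e c v` replaces the coordinates of `c` lying in `e` by the corresponding
coordinates of `v` (the error operation `c ⋄_e v`). -/
def overwrite {F : Type*} {n : ℕ} (e : Finset (Fin n)) (c v : Fin n → F) : Fin n → F :=
  fun i => if i ∈ e then v i else c i

/-- An encoding `C : F^k → F^n` is *error-good* for the hypergraph on `[n]` with edge set
`E` (edges are error sets) if some decoder `D` recovers every message from every codeword
corrupted on the coordinates of any single edge. -/
def ErrorGood {F : Type*} {k n : ℕ} (E : Finset (Finset (Fin n)))
    (C : (Fin k → F) → (Fin n → F)) : Prop :=
  ∃ D : (Fin n → F) → (Fin k → F),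
    ∀ e ∈ E, ∀ m : Fin k → F, ∀ v : Fin n → F, D (overwrite e (C m) v) = m

/-- Two distinct messages of an encoding of `F^k` into `F^n` that survives every pattern of `t`
errors cannot have codewords that agree off a set of at most `2 * t` coordinates. -/
theorem ErrorGood.eq_of_card_le {F : Type*} {k n t : ℕ} {C : (Fin k → F) → (Fin n → F)}
    (hC : ErrorGood ((Finset.univ : Finset (Fin n)).powersetCard t) C) (ht : t ≤ n)
    {A : Finset (Fin n)} (hA : A.card ≤ 2 * t) {m m' : Fin k → F}
    (h : ∀ i ∉ A, C m i = C m' i) : m = m' := by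
  obtain ⟨D, hD⟩ := hC
  obtain ⟨B, hBA, hB⟩ := Finset.exists_subset_card_eq (min_le_right t A.card)
  have hdiff : (A \ B).card ≤ t := by
    rw [Finset.card_sdiff_of_subset hBA]
    omega
  obtain ⟨e₁, hB₁, he₁⟩ := Finset.exists_superset_card_eq (s := B) (n := t) (by omega) (by simpa)
  obtain ⟨e₂, hB₂, he₂⟩ := Finset.exists_superset_card_eq hdiff (by simpa)
  have hw : overwrite e₁ (C m) (C m') = overwrite e₂ (C m') (overwrite e₁ (C m) (C m')) := by
    funext i
    by_cases h₁ : i ∈ e₁ <;> by_cases h₂ : i ∈ e₂ <;>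
      simp only [overwrite, h₁, h₂, if_true, if_false]
    refine h i fun hi => ?_
    by_cases hiB : i ∈ B
    · exact h₁ (hB₁ hiB)
    · exact h₂ (hB₂ (Finset.mem_sdiff.2 ⟨hi, hiB⟩))
  rw [← hD e₁ (by simp [he₁]) m (C m'), hw]
  exact hD e₂ (by simp [he₂]) m' _

/-- An encoding is error-good as soon as distinct messages have codewords that differ
outside the union of any two error sets. -/
theorem errorGood_of_forall_union {F : Type*} {k n : ℕ} (hkn : k ≤ n)
    {E : Finset (Finset (Fin n))} {C : (Fin k → F) → (Fin n → F)}
    (h : ∀ e₁ ∈ E, ∀ e₂ ∈ E, ∀ m m' : Fin k → F,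
      (∀ i ∉ e₁ ∪ e₂, C m i = C m' i) → m = m') : ErrorGood E C := by
  classical
  refine ⟨fun w => if hw : ∃ m, ∃ e ∈ E, ∃ v, overwrite e (C m) v = w then hw.choose
    else w ∘ Fin.castLE hkn, fun e he m v => ?_⟩
  have hw : ∃ m', ∃ e' ∈ E, ∃ v', overwrite e' (C m') v' = overwrite e (C m) v :=
    ⟨m, e, he, v, rfl⟩
  refine (dif_pos hw).trans ?_
  obtain ⟨e', he', v', hv'⟩ := hw.choose_spec
  refine h e' he' e he _ _ fun i hi => ?_
  rw [Finset.mem_union, not_or] at hi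
  simpa [overwrite, hi.1, hi.2] using congrFun hv' i

/-- if every error set of `G = ([n], E)` has size at most `(n-k)/2`
(`n - k` even), `g : [n] → [χ]` is a valid strong-coloring of the complement hypergraph
`Ḡ = ([n], {[n] ∖ e : e ∈ E})`, `χ - k` is even, and `F` admits an encoding `F^k → F^χ`
that is error-good for the complete hypergraph `κ_{χ,(χ-k)/2}`, then there exists an
encoding `F^k → F^n` that is error-good for `G`
(in particular `p_k(G) ≤ p_k(κ_{χ(Ḡ),⌊(χ(Ḡ)-k)/2⌋})`). -/
theorem stmt9 {n k χ : ℕ} (hk : 1 ≤ k) (hkn : k ≤ n)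
    (heven : Even (n - k))
    (E : Finset (Finset (Fin n)))
    (hE : ∀ e ∈ E, e.card ≤ (n - k) / 2)
    (g : Fin n → Fin χ)
    (hg : ∀ e ∈ E, ∀ i₁ ∉ e, ∀ i₂ ∉ e, g i₁ = g i₂ → i₁ = i₂)
    (hχeven : Even (χ - k))
    (F : Type*)
    (hC : ∃ C : (Fin k → F) → (Fin χ → F),
      ErrorGood ((Finset.univ : Finset (Fin χ)).powersetCard ((χ - k) / 2)) C) :
    ∃ C' : (Fin k → F) → (Fin n → F), ErrorGood E C' := by
  obtain ⟨C, hC⟩ := hC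
  refine ⟨fun m i => C m (g i), errorGood_of_forall_union hkn fun e₁ he₁ e₂ he₂ m m' h => ?_⟩
  have hcard : ((e₁ ∪ e₂)ᶜ.image g).card = n - (e₁ ∪ e₂).card := by
    rw [Finset.card_image_of_injOn, Finset.card_compl, Fintype.card_fin]
    intro i hi j hj hij
    simp only [Finset.coe_compl, Finset.coe_union, Set.mem_compl_iff, Set.mem_union,
      Finset.mem_coe, not_or] at hi hj
    exact hg e₁ he₁ i hi.1 j hj.1 hij
  have hunion := Finset.card_union_le e₁ e₂
  have h₁ := hE e₁ he₁
  have h₂ := hE e₂ he₂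
  have hle : ((e₁ ∪ e₂)ᶜ.image g).card ≤ χ := by
    simpa using Finset.card_le_univ ((e₁ ∪ e₂)ᶜ.image g)
  refine hC.eq_of_card_le (A := ((e₁ ∪ e₂)ᶜ.image g)ᶜ) (by omega) ?_ fun c hc => ?_
  · rw [Finset.card_compl, Fintype.card_fin, Nat.two_mul_div_two_of_even hχeven]
    omega
  · obtain ⟨i, hi, rfl⟩ := Finset.mem_image.1 (Finset.notMem_compl.1 hc)
    exact h i (Finset.mem_compl.1 hi)
end

section
/- There exists a hypergraph G = ([N], E) of error sets such that for k = 2: (i) there exists an error-good encoding for G over an alphabet of size 3; (ii) there exists an F_5-linear error-good encoding for G over the field of 5 elements; and (iii) there is no F-linear error-good encoding for G over any finite field F of size less than 5 (in particular over F_2, F_3, or F_4). Thus p_{2,lin}(G) = 5 while p_2(G) ≤ 3, so non-linear error-correcting codes can require a strictly smaller alphabet than linear ones. -/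
/-- An encoding is error-good if and only if, for any two error sets, a message is determined
by the coordinates of its codeword outside both of them. -/
lemma errorGood_iff {F : Type*} [Nonempty F] {k n : ℕ} (E : Finset (Finset (Fin n)))
    (C : (Fin k → F) → (Fin n → F)) :
    ErrorGood E C ↔ ∀ e ∈ E, ∀ e' ∈ E, ∀ m m' : Fin k → F,
      (∀ i, i ∉ e → i ∉ e' → C m i = C m' i) → m = m' := by
  classical
  constructor
  · rintro ⟨D, hD⟩ e he e' he' m m' h
    have hw : overwrite e (C m) (C m') =
        overwrite e' (C m') (fun i => if i ∈ e then C m' i else C m i) := by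
      funext i
      by_cases h1 : i ∈ e <;> by_cases h2 : i ∈ e' <;> simp [overwrite, h1, h2]
      exact h i h1 h2
    rw [← hD e he m (C m'), hw, hD e' he']
  · intro h
    refine ⟨fun w => Classical.epsilon fun m => ∃ e ∈ E, ∃ v, overwrite e (C m) v = w, ?_⟩
    intro e he m v
    obtain ⟨e', he', v', hv'⟩ := Classical.epsilon_spec
      (p := fun m' => ∃ e' ∈ E, ∃ v', overwrite e' (C m') v' = overwrite e (C m) v)
      ⟨m, e, he, v, rfl⟩
    refine h e' he' e he _ _ fun i hi' hi => ?_
    simpa [overwrite, hi, hi'] using congrFun hv' i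

/-- A graph with fewer than six edges is 3-colorable. -/
lemma exists_coloring {X ι : Type*} [Fintype X] [Fintype ι] (hι : Fintype.card ι < 6)
    (x y : ι → X) (hxy : ∀ i, x i ≠ y i) :
    ∃ f : X → Fin 3, ∀ i, f (x i) ≠ f (y i) := by
  classical
  obtain ⟨g, hg, hmin⟩ := Set.exists_min_image {g : X → X | ∀ i, g (x i) ≠ g (y i)}
    (fun g => (Finset.univ.image g).card) (Set.toFinite _) ⟨id, hxy⟩
  have hcard : (Finset.univ.image g).card ≤ 3 := by
    by_contra! h4
    have hlt : (Finset.univ.image fun i => s(g (x i), g (y i))).card <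
        ((Finset.univ.image g).offDiag.image (Function.uncurry Sym2.mk)).card := by
      rw [Sym2.card_image_offDiag]
      calc _ ≤ Fintype.card ι := Finset.card_image_le
        _ < 6 := hι
        _ = Nat.choose 4 2 := rfl
        _ ≤ _ := Nat.choose_le_choose 2 h4
    obtain ⟨p, hp, hp'⟩ := Finset.exists_mem_notMem_of_card_lt_card hlt
    obtain ⟨⟨a, b⟩, hab, rfl⟩ := Finset.mem_image.1 hp
    obtain ⟨ha, hb, hne⟩ := Finset.mem_offDiag.1 hab
    simp only [Finset.mem_image, Finset.mem_univ, true_and, not_exists] at hp'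
    have hle := hmin (fun z => if g z = a then b else g z) (by
      intro i
      have h1 := hp' i
      have h2 := hg i
      dsimp only
      split_ifs <;> grind)
    have hsub : (Finset.univ.image fun z => if g z = a then b else g z) ⊆
        (Finset.univ.image g).erase a := by
      intro w hw
      obtain ⟨z, -, rfl⟩ := Finset.mem_image.1 hw
      dsimp only at hb hne ⊢
      split_ifs with hz
      · exact Finset.mem_erase.2 ⟨hne.symm, hb⟩
      · exact Finset.mem_erase.2 ⟨hz, Finset.mem_image_of_mem g (Finset.mem_univ z)⟩
    have := Finset.card_le_card hsub
    have := Finset.card_erase_lt_of_mem ha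
    dsimp only at *
    omega
  obtain ⟨φ⟩ : Nonempty (Finset.univ.image g ↪ Fin 3) :=
    Function.Embedding.nonempty_of_card_le (by simpa only [Fintype.card_coe, Fintype.card_fin] using hcard)
  refine ⟨fun z => φ ⟨g z, Finset.mem_image_of_mem g (Finset.mem_univ z)⟩, fun i h => hg i ?_⟩
  simpa using φ.injective h

/-- Any family of coordinate sets required to determine the message can be realised through the
complements of unions of two error sets: the coordinates are a copy of `V`, embedded by `ι`,
together with uncoded copies of the message symbols, as recorded by `τ`. -/
lemma exists_errorSets {V : Type} [Fintype V] (k : ℕ) (P : Finset V → Prop) :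
    ∃ (N : ℕ) (E : Finset (Finset (Fin N))) (ι : V → Fin N) (τ : Fin N → V ⊕ Fin k),
      (∀ (A : Type) [Nonempty A] (g : V → (Fin k → A) → A),
        (∀ S, P S → ∀ m m' : Fin k → A, (∀ v ∈ S, g v m = g v m') → m = m') →
        ErrorGood E fun m i => Sum.elim (fun v => g v m) m (τ i)) ∧
      (∀ (A : Type) [Nonempty A] (C : (Fin k → A) → Fin N → A), ErrorGood E C →
        ∀ S, P S → ∀ m m', (∀ v ∈ S, C m (ι v) = C m' (ι v)) → m = m') := by
  classical
  let J := Finset V × Bool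
  let I := V ⊕ (J × J × Fin k)
  let c : J → I → Prop := fun j => Sum.elim (fun v => v ∈ j.1)
    (fun p => (j = p.1 ∨ j = p.2.1) ∧ p.1.1 ≠ p.2.1.1)
  obtain ⟨n, ⟨σ⟩⟩ : ∃ n, Nonempty (I ≃ Fin n) := ⟨_, ⟨Fintype.equivFin I⟩⟩
  let err : J → Finset (Fin n) := fun j =>
    Finset.univ.filter fun i => ¬ c j (σ.symm i)
  have herr : ∀ j i, i ∉ err j ↔ c j (σ.symm i) := by simp [err]
  refine ⟨n, (Finset.univ.filter fun j : J => P j.1).image err,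
    fun v => σ (Sum.inl v), fun i => Sum.map (fun v => v) (fun p => p.2.2) (σ.symm i), ?_, ?_⟩
  · intro A _ g hg
    rw [errorGood_iff]
    simp only [Finset.forall_mem_image, Finset.mem_filter, Finset.mem_univ, true_and, herr]
    intro j hj j' hj' m m' h
    by_cases hjj : j.1 = j'.1
    · refine hg j.1 hj m m' fun v hv => ?_
      simpa using h (σ (Sum.inl v)) (by simpa [c] using hv) (by simpa [c, ← hjj] using hv)
    · funext t
      simpa using h (σ (Sum.inr (j, j', t))) (by simpa [c] using hjj) (by simpa [c] using hjj)
  · intro A _ C hC S hS m m' h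
    rw [errorGood_iff] at hC
    simp only [Finset.forall_mem_image, Finset.mem_filter, Finset.mem_univ, true_and, herr] at hC
    refine @hC (S, false) hS (S, true) hS m m' fun i => ?_
    obtain ⟨z, rfl⟩ := σ.surjective i
    rw [σ.symm_apply_apply]
    rcases z with v | ⟨p, q, t⟩
    · exact fun hv _ => h v hv
    · rintro ⟨h1, hne⟩ ⟨h2, -⟩
      exfalso
      dsimp only at h1 h2 hne
      rcases h1 with rfl | rfl <;> rcases h2 with h2 | h2
      · exact absurd (congrArg Prod.snd h2) (by simp)
      · exact hne (congrArg Prod.fst h2 :)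
      · exact hne (congrArg Prod.fst h2 :).symm
      · exact absurd (congrArg Prod.snd h2) (by simp)

/-- Pairwise independent vectors of `𝔽₅²`, indexed by the pairs `a < b` in `Fin 4`. -/
def edgeVector : Fin 4 → Fin 4 → ZMod 5 × ZMod 5
  | 0, 1 => (1, 0)
  | 0, 2 => (1, 1)
  | 0, 3 => (1, 2)
  | 1, 2 => (1, 3)
  | 1, 3 => (1, 4)
  | _, _ => (0, 1)

lemma edgeVector_det_ne_zero : ∀ a b c d : Fin 4, a < b → c < d → (a, b) ≠ (c, d) →
    (edgeVector a b).1 * (edgeVector c d).2 - (edgeVector a b).2 * (edgeVector c d).1 ≠ 0 := by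
  decide

lemma exists_lt_map_eq {X : Type*} (p : Fin 4 → X) (f : X → Fin 3) :
    ∃ q : Fin 4 × Fin 4, q.1 < q.2 ∧ f (p q.1) = f (p q.2) := by
  obtain ⟨a, b, hne, h⟩ := Fintype.exists_ne_map_eq_of_card_lt (fun a => f (p a)) (by simp)
  rcases lt_or_gt_of_ne hne with hlt | hlt
  · exact ⟨(a, b), hlt, h⟩
  · exact ⟨(b, a), hlt, h.symm⟩

/-- Every family of functions `X → Fin 3` separating the points of `X` spans `𝔽₅²` under a suitable
assignment of vectors to functions. -/
lemma exists_linear_of_separating {X : Type*} (p : Fin 4 ↪ X) :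
    ∃ L : (X → Fin 3) → (Fin 2 → ZMod 5) →ₗ[ZMod 5] ZMod 5, ∀ S : Finset (X → Fin 3),
      (∀ x y, (∀ f ∈ S, f x = f y) → x = y) →
      ∀ m m', (∀ f ∈ S, L f m = L f m') → m = m' := by
  have : Fact (Nat.Prime 5) := ⟨by norm_num⟩
  choose q hlt heq using exists_lt_map_eq (X := X) p
  refine ⟨fun f => (edgeVector (q f).1 (q f).2).1 • LinearMap.proj 0 +
    (edgeVector (q f).1 (q f).2).2 • LinearMap.proj 1, fun S hS m m' h => ?_⟩
  obtain ⟨f, hf, g, hg, hfg⟩ : ∃ f ∈ S, ∃ g ∈ S, q f ≠ q g := by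
    by_contra! hall
    obtain ⟨f, hf⟩ : S.Nonempty := by
      by_contra hne
      rw [Finset.not_nonempty_iff_eq_empty] at hne
      exact absurd (p.injective (hS (p 0) (p 1) (by simp [hne]))) (by decide)
    refine (hlt f).ne (p.injective (hS _ _ fun g hg => ?_))
    rw [hall f hf g hg]
    exact heq g
  have hdet := edgeVector_det_ne_zero _ _ _ _ (hlt f) (hlt g) hfg
  have h1 := h f hf
  have h2 := h g hg
  simp only [LinearMap.add_apply, LinearMap.smul_apply, LinearMap.proj_apply, smul_eq_mul]
    at h1 h2
  generalize edgeVector (q f).1 (q f).2 = u at *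
  generalize edgeVector (q g).1 (q g).2 = w at *
  have e0 : m 0 - m' 0 = 0 := (mul_eq_zero.1 (by linear_combination w.2 * h1 - u.2 * h2 :
    (u.1 * w.2 - u.2 * w.1) * (m 0 - m' 0) = 0)).resolve_left hdet
  have e1 : m 1 - m' 1 = 0 := (mul_eq_zero.1 (by linear_combination u.1 * h2 - w.1 * h1 :
    (u.1 * w.2 - u.2 * w.1) * (m 1 - m' 1) = 0)).resolve_left hdet
  funext t
  fin_cases t
  · exact sub_eq_zero.1 e0
  · exact sub_eq_zero.1 e1

/-- Over a field with fewer than five elements, no assignment of linear forms in two variables to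
the functions `X → Fin 3` has every separating family span. -/
lemma not_linear_of_card_lt {X F : Type*} [Fintype X] [Field F] [Fintype F]
    (hF : Fintype.card F < 5)
    (L : (X → Fin 3) → (Fin 2 → F) →ₗ[F] F)
    (hL : ∀ S : Finset (X → Fin 3), (∀ x y, (∀ f ∈ S, f x = f y) → x = y) →
      ∀ m m', (∀ f ∈ S, L f m = L f m') → m = m') : False := by
  classical
  let d : Option F → Fin 2 → F := fun o => o.elim ![0, 1] fun t => ![1, t]
  have hd : ∀ o, d o ≠ 0 := by
    rintro (_ | t) h
    · simpa [d] using congrFun h 1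
    · simpa [d] using congrFun h 0
  have hcol : ∀ o, ∃ x y : X, (∀ f, L f (d o) = 0 → f x = f y) ∧ x ≠ y := by
    intro o
    by_contra! hsep
    refine hd o (hL (Finset.univ.filter fun f => L f (d o) = 0) (fun x y h => ?_) _ 0 ?_)
    · exact hsep x y fun f hf => h f (by simpa using hf)
    · intro f hf
      simpa using hf
  choose x y hxy hne using hcol
  obtain ⟨f, hf⟩ := exists_coloring (by rw [Fintype.card_option]; omega) x y hne
  obtain ⟨o, ho⟩ : ∃ o, L f (d o) = 0 := by
    by_cases hb : L f ![0, 1] = 0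
    · exact ⟨none, hb⟩
    · refine ⟨some (-(L f ![1, 0] / L f ![0, 1])), ?_⟩
      have hsplit : d (some (-(L f ![1, 0] / L f ![0, 1]))) =
          ![1, 0] + (-(L f ![1, 0] / L f ![0, 1])) • ![0, 1] := by
        funext t
        fin_cases t <;> simp [d]
      rw [hsplit, map_add, map_smul, smul_eq_mul]
      field_simp
      ring
  exact hf o (hxy o f ho)

/-- non-linear codes outperform linear codes: there exists a hypergraph
`G = ([N], E)` of error sets such that for `k = 2`: (i) there is an error-good encoding
for `G` over an alphabet of size 3; (ii) there is an `F₅`-linear error-good encoding for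
`G` over the field of 5 elements; and (iii) there is no `F`-linear error-good encoding
for `G` over any finite field `F` with `|F| < 5`. Hence `p_{2,lin}(G) = 5` while
`p₂(G) ≤ 3`. -/
theorem stmt14 :
    ∃ (N : ℕ) (E : Finset (Finset (Fin N))),
      (∃ C : (Fin 2 → Fin 3) → (Fin N → Fin 3), ErrorGood E C) ∧
      (∃ C : (Fin 2 → ZMod 5) →ₗ[ZMod 5] (Fin N → ZMod 5), ErrorGood E (fun m => C m)) ∧
      (∀ (F : Type) [Field F] [Fintype F], Fintype.card F < 5 →
        ¬ ∃ C : (Fin 2 → F) →ₗ[F] (Fin N → F), ErrorGood E (fun m => C m)) := by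
  classical
  obtain ⟨N, E, ι, τ, hgood, hsep⟩ := exists_errorSets (V := (Fin 2 → Fin 3) → Fin 3) 2
    fun S => ∀ x y, (∀ f ∈ S, f x = f y) → x = y
  refine ⟨N, E, ⟨_, hgood (Fin 3) (fun f => f) fun S hS => hS⟩, ?_, ?_⟩
  · obtain ⟨p⟩ : Nonempty (Fin 4 ↪ (Fin 2 → Fin 3)) :=
      Function.Embedding.nonempty_of_card_le (by simp)
    obtain ⟨L, hL⟩ := exists_linear_of_separating p
    refine ⟨LinearMap.pi fun i => Sum.elim L LinearMap.proj (τ i), ?_⟩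
    convert hgood (ZMod 5) (fun f => L f) hL using 3 with m i
    rw [LinearMap.pi_apply]
    rcases τ i with f | t <;> rfl
  · rintro F _ _ hF ⟨C, hC⟩
    exact not_linear_of_card_lt hF (fun f => LinearMap.proj (ι f) ∘ₗ C) (hsep F _ hC)
end

section
/- Let k, c, n be positive integers with k ≤ c and c dividing n. Partition [n] into c blocks, each of size n/c, and color every vertex by the index of its block. Then the number of k-element subsets of [n] whose elements lie in k pairwise distinct blocks equals binom(c,k)·(n/c)^k, and this quantity satisfies binom(c,k)·(n/c)^k ≥ (1 − k²/c)·binom(n,k). Consequently, for every ε > 0 with c ≥ k²/ε, this block coloring is a valid (1−ε)-k-coloring of the complete k-uniform hypergraph κ_{n,k}, so χ_{ε,k}(κ_{n,k}) ≤ c; in particular χ_{ε,k}(κ_{n,k}) = O(k²/ε). -/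
open Finset in
/-- The sets that meet each fibre over `T` exactly once, and no other fibre, are counted by the
product of the sizes of the fibres over `T`. -/
theorem card_filter_image_eq_and_card_eq {α β : Type*} [Fintype α] [DecidableEq α] [DecidableEq β]
    (f : α → β) (T : Finset β) :
    #{S : Finset α | S.image f = T ∧ #S = #T} = ∏ b ∈ T, #{a | f a = b} := by
  rw [← Finset.card_pi]
  symm
  have hf : ∀ g ∈ T.pi (fun b => ({a | f a = b} : Finset α)), ∀ b (hb : b ∈ T),
      f (g b hb) = b := by
    intro g hg b hb
    simpa using Finset.mem_pi.1 hg b hb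
  refine Finset.card_bij (fun g _ => T.attach.image fun b => g b.1 b.2) ?_ ?_ ?_
  · intro g hg
    have hfg := hf g hg
    refine Finset.mem_filter.2 ⟨Finset.mem_univ _, ?_, ?_⟩
    · ext b
      simp only [Finset.mem_image, Finset.mem_attach, true_and, Subtype.exists]
      constructor
      · rintro ⟨a, ⟨b', hb', rfl⟩, rfl⟩
        rwa [hfg]
      · intro hb
        exact ⟨g b hb, ⟨b, hb, rfl⟩, hfg b hb⟩
    · rw [Finset.card_image_of_injective, Finset.card_attach]
      rintro ⟨b, hb⟩ ⟨b', hb'⟩ h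
      have := congrArg f h
      simp only [hfg] at this
      exact Subtype.ext this
  · intro g hg g' hg' h
    funext b hb
    have hmem : g b hb ∈ T.attach.image fun b => g' b.1 b.2 := by
      rw [← h]
      exact Finset.mem_image.2 ⟨⟨b, hb⟩, Finset.mem_attach _ _, rfl⟩
    obtain ⟨⟨b', hb'⟩, -, he⟩ := Finset.mem_image.1 hmem
    have hbb := congrArg f he
    simp only [hf g hg, hf g' hg'] at hbb
    subst hbb
    exact he.symm
  · intro S hS
    obtain ⟨-, hST, hcard⟩ := Finset.mem_filter.1 hS
    have hex : ∀ b ∈ T, ∃ a ∈ S, f a = b := by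
      intro b hb
      rw [← hST] at hb
      exact Finset.mem_image.1 hb
    choose g hgS hgf using hex
    refine ⟨g, Finset.mem_pi.2 fun b hb => by simpa using hgf b hb, ?_⟩
    apply Finset.eq_of_subset_of_card_le
    · intro a ha
      obtain ⟨⟨b, hb⟩, -, rfl⟩ := Finset.mem_image.1 ha
      exact hgS b hb
    · rw [hcard, Finset.card_image_of_injective, Finset.card_attach]
      rintro ⟨b, hb⟩ ⟨b', hb'⟩ h
      have := congrArg f h
      simp only [hgf] at this
      exact Subtype.ext this

open Finset in
/-- If all colour classes have size `m`, then the number of rainbow `k`-sets is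
`(card β).choose k * m ^ k`. -/
theorem card_rainbow_powersetCard {α β : Type*} [Fintype α] [Fintype β] [DecidableEq α]
    [DecidableEq β] (f : α → β) (m k : ℕ) (hf : ∀ b, #{a | f a = b} = m) :
    #{S ∈ (univ : Finset α).powersetCard k | #(S.image f) = k} =
      (Fintype.card β).choose k * m ^ k := by
  have hmaps : ∀ S ∈ {S ∈ (univ : Finset α).powersetCard k | #(S.image f) = k},
      S.image f ∈ (univ : Finset β).powersetCard k := by
    intro S hS
    exact Finset.mem_powersetCard.2 ⟨Finset.subset_univ _, (Finset.mem_filter.1 hS).2⟩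
  rw [Finset.card_eq_sum_card_fiberwise hmaps]
  have hfib : ∀ T ∈ (univ : Finset β).powersetCard k,
      #{S ∈ {S ∈ (univ : Finset α).powersetCard k | #(S.image f) = k} | S.image f = T} =
        m ^ k := by
    intro T hT
    have hTk := (Finset.mem_powersetCard.1 hT).2
    calc _ = #{S : Finset α | S.image f = T ∧ #S = #T} := by
          congr 1
          ext S
          simp only [Finset.mem_filter, Finset.mem_powersetCard, Finset.mem_univ, true_and,
            Finset.subset_univ, hTk]
          constructor
          · rintro ⟨⟨h, -⟩, h'⟩
            exact ⟨h', h⟩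
          · rintro ⟨rfl, h⟩
            exact ⟨⟨h, hTk⟩, rfl⟩
      _ = m ^ k := by
          rw [card_filter_image_eq_and_card_eq, Finset.prod_congr rfl fun b _ => hf b,
            Finset.prod_const, hTk]
  rw [Finset.sum_congr rfl hfib, Finset.sum_const, Finset.card_powersetCard, Finset.card_univ,
    smul_eq_mul]

open Finset in
theorem Fin.card_filter_val_div_eq {c m b : ℕ} (hm : 0 < m) (hb : b < c) :
    #{i : Fin (c * m) | i.val / m = b} = m := by
  have h : ({i : Fin (c * m) | i.val / m = b} : Finset _).map Fin.valEmbedding =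
      Finset.Ico (b * m) ((b + 1) * m) := by
    ext x
    simp only [Finset.mem_map, Finset.mem_filter, Finset.mem_univ, true_and,
      Fin.valEmbedding_apply, Finset.mem_Ico]
    constructor
    · rintro ⟨i, rfl, rfl⟩
      exact ⟨Nat.div_mul_le_self _ _, Nat.lt_mul_of_div_lt (Nat.lt_succ_self _) hm⟩
    · rintro ⟨h₁, h₂⟩
      exact ⟨⟨x, h₂.trans_le (Nat.mul_le_mul_right m hb)⟩,
        Nat.div_eq_of_lt_le h₁ h₂, rfl⟩
  rw [← Finset.card_map Fin.valEmbedding, h, Nat.card_Ico, ← Nat.sub_mul]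
  simp

theorem one_sub_sq_div_mul_pow_le_descFactorial {c k : ℕ} (hkc : k ≤ c) :
    (1 - (k : ℝ) ^ 2 / c) * (c : ℝ) ^ k ≤ c.descFactorial k := by
  induction k with
  | zero => simp
  | succ k ih =>
    have hc : (0 : ℝ) < c := by exact_mod_cast (by omega : 0 < c)
    have hk : (k : ℝ) ≤ c := by exact_mod_cast (by omega : k ≤ c)
    rw [Nat.descFactorial_succ, Nat.cast_mul, Nat.cast_sub (by omega)]
    refine le_trans ?_ (mul_le_mul_of_nonneg_left (ih (by omega)) (sub_nonneg.2 hk))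
    have key : ((c : ℝ) - k) * ((1 - (k : ℝ) ^ 2 / c) * (c : ℝ) ^ k) -
        (1 - ((k + 1 : ℕ) : ℝ) ^ 2 / c) * (c : ℝ) ^ (k + 1) =
        (k + 1 + (k : ℝ) ^ 3 / c) * (c : ℝ) ^ k := by
      push_cast
      field_simp
      ring
    have : 0 ≤ (k + 1 + (k : ℝ) ^ 3 / c) * (c : ℝ) ^ k := by positivity
    linarith

theorem one_sub_sq_div_mul_choose_le {c k : ℕ} (m : ℕ) (hkc : k ≤ c) :
    (1 - (k : ℝ) ^ 2 / c) * ((c * m).choose k) ≤ ((c.choose k * m ^ k : ℕ) : ℝ) := by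
  rcases le_total (1 - (k : ℝ) ^ 2 / c) 0 with h | h
  · exact (mul_nonpos_of_nonpos_of_nonneg h (Nat.cast_nonneg _)).trans (Nat.cast_nonneg _)
  have hfac : (0 : ℝ) < (k.factorial : ℝ) := by exact_mod_cast k.factorial_pos
  have h1 : (k.factorial : ℝ) * ((c * m).choose k) ≤ (c : ℝ) ^ k * (m : ℝ) ^ k := by
    rw [← mul_pow]
    exact_mod_cast (Nat.descFactorial_eq_factorial_mul_choose (c * m) k) ▸
      Nat.descFactorial_le_pow (c * m) k
  have h2 : (c.descFactorial k : ℝ) = k.factorial * c.choose k := by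
    exact_mod_cast Nat.descFactorial_eq_factorial_mul_choose c k
  refine le_of_mul_le_mul_left ?_ hfac
  calc (k.factorial : ℝ) * ((1 - (k : ℝ) ^ 2 / c) * ((c * m).choose k))
      = (1 - (k : ℝ) ^ 2 / c) * (k.factorial * ((c * m).choose k)) := by ring
    _ ≤ (1 - (k : ℝ) ^ 2 / c) * ((c : ℝ) ^ k * (m : ℝ) ^ k) := mul_le_mul_of_nonneg_left h1 h
    _ = (1 - (k : ℝ) ^ 2 / c) * (c : ℝ) ^ k * (m : ℝ) ^ k := by ring
    _ ≤ c.descFactorial k * (m : ℝ) ^ k :=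
        mul_le_mul_of_nonneg_right (one_sub_sq_div_mul_pow_le_descFactorial hkc) (by positivity)
    _ = (k.factorial : ℝ) * ((c.choose k * m ^ k : ℕ) : ℝ) := by rw [h2]; push_cast; ring


/-- for `k ≤ c`, `c ∣ n`, partition `[n]` into `c` blocks of size `n/c` and
color each vertex by the index of its block (`col i = ⌊i/(n/c)⌋`). Then the number of
`k`-element subsets of `[n]` whose elements lie in `k` pairwise distinct blocks equals
`binom(c,k)·(n/c)^k ≥ (1 - k²/c)·binom(n,k)`; consequently, for every `ε > 0` with
`c ≥ k²/ε` this block coloring is a valid `(1-ε)`-`k`-coloring of `κ_{n,k}`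
(so `χ_{ε,k}(κ_{n,k}) ≤ c = O(k²/ε)`). -/
theorem stmt18 {k c n : ℕ} (hk : 0 < k) (hc : 0 < c) (hn : 0 < n)
    (hkc : k ≤ c) (hdvd : c ∣ n)
    (col : Fin n → Fin c) (hcol : ∀ i : Fin n, (col i).val = i.val / (n / c)) :
    ((((Finset.univ : Finset (Fin n)).powersetCard k).filter
        (fun S => (S.image col).card = k)).card = c.choose k * (n / c) ^ k) ∧
    ((1 - (k : ℝ) ^ 2 / c) * (n.choose k) ≤ ((c.choose k * (n / c) ^ k : ℕ) : ℝ)) ∧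
    (∀ ε : ℝ, 0 < ε → (k : ℝ) ^ 2 / ε ≤ c →
      (1 - ε) * (n.choose k) ≤
        (((((Finset.univ : Finset (Fin n)).powersetCard k).filter
          (fun S => k ≤ (S.image col).card)).card : ℕ) : ℝ)) := by
  obtain ⟨m, rfl⟩ := hdvd
  have hm : 0 < m := Nat.pos_of_mul_pos_left hn
  rw [Nat.mul_div_cancel_left m hc] at *
  have hfib : ∀ b : Fin c, (Finset.univ.filter fun i => col i = b).card = m := by
    intro b
    simp only [Fin.ext_iff, hcol]
    exact Fin.card_filter_val_div_eq hm b.isLt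
  have hcount := card_rainbow_powersetCard col m k hfib
  rw [Fintype.card_fin] at hcount
  have hineq := one_sub_sq_div_mul_choose_le m hkc
  refine ⟨hcount, hineq, fun ε hε hkε => ?_⟩
  have hc' : (0 : ℝ) < c := by exact_mod_cast hc
  have hle : (k : ℝ) ^ 2 / c ≤ ε := by
    rw [div_le_iff₀ hε] at hkε
    rw [div_le_iff₀ hc']
    linarith
  refine (mul_le_mul_of_nonneg_right (by linarith) (Nat.cast_nonneg _)).trans (hineq.trans ?_)
  rw [← hcount]
  refine Nat.cast_le.2 (Finset.card_le_card fun S hS => ?_)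
  rw [Finset.mem_filter] at hS ⊢
  exact ⟨hS.1, hS.2.ge⟩
end
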